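/- arXiv:1708.04165 — 2 statements merged into one kernel-verified Lean document; each statement's English description precedes it below -/
import Mathlib

section
/- If μ is an (m×d)-matrix-valued finite Radon measure on ℝ^m whose column-wise distributional divergence vanishes (i.e. ∫ ∇φ(y) dμ(y) = 0 for every φ ∈ C_c^∞(ℝ^m)), then μ has no atoms: μ({a}) = 0 for every a ∈ ℝ^m. -/
open MeasureTheory Filter Set
open scoped Topology ENNReal

abbrev Msp (m : ℕ) : Type := Fin m → ℝ
abbrev Mat (m d : ℕ) : Type := Fin m → Fin d → ℝ

theorem exists_test (m : ℕ) (k : Fin m) : ∃ ψ : Msp m → ℝ, ContDiff ℝ (⊤ : ℕ∞) ψ ∧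
    HasCompactSupport ψ ∧ ∀ v, fderiv ℝ ψ 0 v = v k := by
  let χ : ContDiffBump (0 : Msp m) := ⟨1, 2, by norm_num, by norm_num⟩
  refine ⟨fun z => χ z * z k, ?_, ?_, ?_⟩
  · exact χ.contDiff.mul (contDiff_apply ℝ ℝ k)
  · exact χ.hasCompactSupport.mul_right
  · intro v
    have h : (fun z : Msp m => χ z * z k) =ᶠ[𝓝 0] fun z => (ContinuousLinearMap.proj (R := ℝ) (φ := fun _ : Fin m => ℝ) k) z := by
      filter_upwards [χ.eventuallyEq_one] with z hz
      simp [hz]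
    rw [h.fderiv_eq, ContinuousLinearMap.fderiv]
    rfl

/-- A finite matrix-valued Radon measure `μ = σ.withDensityᵥ ρ` on `ℝ^m`
whose column-wise distributional divergence vanishes, i.e.
`∫ ∇φ(y) dμ(y) = 0` (columnwise) for every `φ ∈ C_c^∞(ℝ^m)`, has no atoms. -/
theorem stmt1 {m d : ℕ} (σ : Measure (Msp m)) [IsFiniteMeasure σ]
    (ρ : Msp m → Mat m d) (hρ : Integrable ρ σ)
    (hdiv : ∀ φ : Msp m → ℝ, ContDiff ℝ (⊤ : ℕ∞) φ → HasCompactSupport φ →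
      ∀ j : Fin d,
        ∫ y, (∑ i, fderiv ℝ φ y (Pi.single i 1) * ρ y i j) ∂σ = 0)
    (a : Msp m) :
    (σ.withDensityᵥ ρ) {a} = 0 := by
  rw [withDensityᵥ_apply hρ (measurableSet_singleton a), Measure.restrict_singleton,
    integral_smul_measure, integral_dirac]
  funext k j
  obtain ⟨ψ, hψ, hc, h0⟩ := exists_test m k
  have hρij : ∀ i j, Integrable (fun y => ρ y i j) σ := fun i j => (hρ.eval i).eval j
  have hcont : Continuous (fderiv ℝ ψ) := hψ.continuous_fderiv (by simp)
  have hc' : HasCompactSupport (fderiv ℝ ψ) := hc.fderiv ℝ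
  obtain ⟨C, hC⟩ := hc'.exists_bound_of_continuous hcont
  have hfd : ∀ (n : ℕ) y, fderiv ℝ (fun y => ((n:ℝ)+1)⁻¹ * ψ (((n:ℝ)+1) • (y - a))) y
      = fderiv ℝ ψ (((n:ℝ)+1) • (y - a)) := by
    intro n y
    have hn : ((n:ℝ)+1) ≠ 0 := by positivity
    have h1 : HasFDerivAt (fun y : Msp m => ((n:ℝ)+1) • (y - a))
        (((n:ℝ)+1) • ContinuousLinearMap.id ℝ (Msp m)) y :=
      ((hasFDerivAt_id (𝕜 := ℝ) y).sub_const a).const_smul ((n:ℝ)+1)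
    have h2 := ((hψ.differentiable (by simp)) (((n:ℝ)+1) • (y - a))).hasFDerivAt
    have h3 := (h2.comp y h1).const_mul ((n:ℝ)+1)⁻¹
    refine h3.fderiv.trans ?_
    ext v
    simp [hn]
  have hzero : ∀ n : ℕ, ∫ y, (∑ i, fderiv ℝ ψ (((n:ℝ)+1) • (y - a)) (Pi.single i 1) * ρ y i j) ∂σ
      = 0 := by
    intro n
    have hn : ((n:ℝ)+1) ≠ 0 := by positivity
    have := hdiv (fun y => ((n:ℝ)+1)⁻¹ * ψ (((n:ℝ)+1) • (y - a))) ?_ ?_ j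
    · simpa only [hfd] using this
    · exact contDiff_const.mul (hψ.comp (by fun_prop))
    · refine HasCompactSupport.mul_left ?_
      exact hc.comp_homeomorph ((Homeomorph.subRight a).trans (Homeomorph.smulOfNeZero _ hn))
  have hlim : Tendsto (fun n : ℕ => ∫ y, (∑ i, fderiv ℝ ψ (((n:ℝ)+1) • (y - a)) (Pi.single i 1) * ρ y i j) ∂σ)
      atTop (𝓝 (∫ y, ({a} : Set (Msp m)).indicator (fun y => ρ y k j) y ∂σ)) := by
    refine tendsto_integral_of_dominated_convergence
      (fun y => ∑ i, (C * ‖(Pi.single i 1 : Msp m)‖) * ‖ρ y i j‖) ?_ ?_ ?_ ?_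
    · intro n
      refine Finset.aestronglyMeasurable_fun_sum _ fun i _ => ?_
      refine AEStronglyMeasurable.mul ?_ (hρij i j).aestronglyMeasurable
      refine Continuous.aestronglyMeasurable ?_
      exact (hcont.comp (by fun_prop)).clm_apply continuous_const
    · exact integrable_finsetSum _ fun i _ => (hρij i j).norm.const_mul _
    · intro n
      refine ae_of_all _ fun y => (norm_sum_le _ _).trans (Finset.sum_le_sum fun i _ => ?_)
      rw [norm_mul]
      gcongr
      exact (ContinuousLinearMap.le_opNorm _ _).trans (by gcongr; exact hC _)
    · refine ae_of_all _ fun y => ?_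
      by_cases hy : y = a
      · subst hy
        simp [h0, Pi.single_apply]
      · rw [indicator_of_notMem (by simpa using hy)]
        refine tendsto_const_nhds.congr' ?_
        obtain ⟨R, hR⟩ := hc'.isCompact.isBounded.subset_closedBall 0
        have hpos : 0 < ‖y - a‖ := norm_pos_iff.2 (sub_ne_zero.2 hy)
        have ht : Tendsto (fun n : ℕ => ((n:ℝ)+1) * ‖y - a‖) atTop atTop :=
          (tendsto_atTop_add_const_right _ _ tendsto_natCast_atTop_atTop).atTop_mul_const hpos
        filter_upwards [ht.eventually_gt_atTop R] with n hn
        have : fderiv ℝ ψ (((n:ℝ)+1) • (y - a)) = 0 := by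
          refine image_eq_zero_of_notMem_tsupport fun hmem => ?_
          have h5 := hR hmem
          rw [mem_closedBall_zero_iff, norm_smul, Real.norm_of_nonneg (by positivity)] at h5
          linarith
        simp [this]
  simp only [hzero] at hlim
  have := tendsto_nhds_unique hlim tendsto_const_nhds
  rw [integral_indicator (measurableSet_singleton a), Measure.restrict_singleton,
    integral_smul_measure, integral_dirac] at this
  simpa using this
end

section
/- Let a ≠ b in ℝ^m and let μ ∈ M(ℝ^m; ℝ^{m×d}) satisfy div μ ≡ 0 (column-wise distributional divergence) and |μ|(ℝ^m ∖ [a,b]) = 0. Then μ = 0. -/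
open MeasureTheory Filter Set
open scoped Topology ENNReal

/-- Smooth functions on the line have smooth antiderivatives. -/
lemma exists_antideriv (h : ℝ → ℝ) (hh : ContDiff ℝ (⊤ : ℕ∞) h) :
    ∃ H : ℝ → ℝ, ContDiff ℝ (⊤ : ℕ∞) H ∧ ∀ s, HasDerivAt H (h s) s := by
  have hd : ∀ s, HasDerivAt (fun s => ∫ x in (0:ℝ)..s, h x) (h s) s := fun s =>
    hh.continuous.integral_hasStrictDerivAt 0 s |>.hasDerivAt
  refine ⟨_, ?_, hd⟩
  rw [contDiff_infty_iff_deriv]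
  refine ⟨fun s => (hd s).differentiableAt, ?_⟩
  have : deriv (fun s => ∫ x in (0:ℝ)..s, h x) = h := funext fun s => (hd s).deriv
  rw [this]
  exact hh

/-- Cutoff near a compact set. -/
lemma exists_cutoff {m : ℕ} (K : Set (EuclideanSpace ℝ (Fin m))) (hK : IsCompact K)
    (g : EuclideanSpace ℝ (Fin m) → ℝ) (hg : ContDiff ℝ (⊤ : ℕ∞) g) :
    ∃ φ : EuclideanSpace ℝ (Fin m) → ℝ, ContDiff ℝ (⊤ : ℕ∞) φ ∧ HasCompactSupport φ ∧
      ∀ y ∈ K, fderiv ℝ φ y = fderiv ℝ g y := by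
  obtain ⟨R, hR⟩ := hK.isBounded.subset_ball (0 : EuclideanSpace ℝ (Fin m))
  let R' := max R 1
  let c : ContDiffBump (0 : EuclideanSpace ℝ (Fin m)) :=
    ⟨R', R' + 1, by positivity, by linarith⟩
  refine ⟨fun y => c y * g y, c.contDiff.mul hg, c.hasCompactSupport.mul_right, ?_⟩
  intro y hy
  apply Filter.EventuallyEq.fderiv_eq
  have hy' : y ∈ Metric.ball (0 : EuclideanSpace ℝ (Fin m)) c.rIn :=
    Metric.ball_subset_ball (le_max_left R 1) (hR hy)
  filter_upwards [Metric.isOpen_ball.mem_nhds hy'] with z hz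
  rw [c.one_of_mem_closedBall (Metric.ball_subset_closedBall hz), one_mul]

/-- Let `a ≠ b` in `ℝ^m` and let `μ = κ.withDensityᵥ ρ` be a
matrix-valued measure on `ℝ^m` with `div μ ≡ 0` (columnwise distributional divergence)
and with total variation concentrated on the segment `[a,b]`. Then `μ = 0`. -/
theorem stmt10 {m d : ℕ} (a b : EuclideanSpace ℝ (Fin m)) (hab : a ≠ b)
    (κ : Measure (EuclideanSpace ℝ (Fin m))) [IsFiniteMeasure κ]
    (ρ : EuclideanSpace ℝ (Fin m) → Mat m d) (hρ : Integrable ρ κ)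
    (hdiv : ∀ φ : EuclideanSpace ℝ (Fin m) → ℝ,
      ContDiff ℝ (⊤ : ℕ∞) φ → HasCompactSupport φ → ∀ j : Fin d,
        ∫ y, (∑ i, fderiv ℝ φ y (EuclideanSpace.single i 1) * ρ y i j) ∂κ = 0)
    (hsupp : κ (segment ℝ a b)ᶜ = 0) :
    κ.withDensityᵥ ρ = 0 := by
  have hseg : ∀ᵐ y ∂κ, y ∈ segment ℝ a b := by
    rw [ae_iff]; exact hsupp
  have hKc : IsCompact (segment ℝ a b) := by
    rw [segment_eq_image_lineMap]
    exact isCompact_Icc.image AffineMap.lineMap_continuous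
  have hcomp : ∀ (k : Fin m) (j : Fin d), Integrable (fun y => ρ y k j) κ := fun k j =>
    (hρ.eval k).eval j
  have key : ∀ (k : Fin m) (j : Fin d), ∀ᵐ y ∂κ, ρ y k j = 0 := by
    intro k j
    apply ae_eq_zero_of_integral_contDiff_smul_eq_zero (hcomp k j).locallyIntegrable
    intro g hg _
    have hv : b - a ≠ 0 := sub_ne_zero.mpr hab.symm
    obtain ⟨L, hL⟩ : ∃ L : EuclideanSpace ℝ (Fin m) →L[ℝ] ℝ, L (b - a) = 1 := by
      refine ⟨(‖b - a‖ ^ 2)⁻¹ • innerSL ℝ (b - a), ?_⟩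
      have : ‖b - a‖ ≠ 0 := norm_ne_zero_iff.mpr hv
      simp only [ContinuousLinearMap.smul_apply, innerSL_apply_apply,
        real_inner_self_eq_norm_sq, smul_eq_mul]
      field_simp
    let P : EuclideanSpace ℝ (Fin m) →L[ℝ] ℝ := EuclideanSpace.proj k
    let h : ℝ → ℝ := fun s => g (a + s • (b - a))
    have hh : ContDiff ℝ (⊤ : ℕ∞) h :=
      hg.comp (contDiff_const.add (contDiff_id.smul contDiff_const))
    obtain ⟨H, hH, hHd⟩ := exists_antideriv h hh
    let t : EuclideanSpace ℝ (Fin m) → ℝ := fun y => L (y - a)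
    have ht : ContDiff ℝ (⊤ : ℕ∞) t := L.contDiff.comp (contDiff_id.sub contDiff_const)
    have htd : ∀ y, HasFDerivAt t L y := fun y => by
      simpa [t, Function.comp_def] using
        L.hasFDerivAt.comp y ((hasFDerivAt_id y).sub_const a)
    let Q : EuclideanSpace ℝ (Fin m) →L[ℝ] ℝ := P - P (b - a) • L
    let q : EuclideanSpace ℝ (Fin m) → ℝ := fun y => Q (y - a)
    have hq : ContDiff ℝ (⊤ : ℕ∞) q := Q.contDiff.comp (contDiff_id.sub contDiff_const)
    have hqd : ∀ y, HasFDerivAt q Q y := fun y => by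
      simpa [q, Function.comp_def] using
        Q.hasFDerivAt.comp y ((hasFDerivAt_id y).sub_const a)
    let G : EuclideanSpace ℝ (Fin m) → ℝ := fun y => h (t y) * q y + P (b - a) * H (t y)
    have hG : ContDiff ℝ (⊤ : ℕ∞) G :=
      ((hh.comp ht).mul hq).add (contDiff_const.mul (hH.comp ht))
    have hGd : ∀ y ∈ segment ℝ a b, fderiv ℝ G y = g y • P := by
      intro y hy
      rw [segment_eq_image'] at hy
      obtain ⟨s, -, rfl⟩ := hy
      have hts : t (a + s • (b - a)) = s := by simp [t, hL, -map_sub]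
      have hqs : q (a + s • (b - a)) = 0 := by simp [q, Q, hL, -map_sub]; ring
      have h1 : HasDerivAt h (deriv h (t (a + s • (b - a)))) (t (a + s • (b - a))) :=
        (hh.differentiable (by simp) _).hasDerivAt
      have h2 := (h1.comp_hasFDerivAt _ (htd _)).mul (hqd (a + s • (b - a)))
      have h3 := ((hHd (t (a + s • (b - a)))).comp_hasFDerivAt _ (htd _)).const_mul (P (b - a))
      have h4 : HasFDerivAt G _ _ := h2.add h3
      rw [h4.fderiv]
      ext z
      simp [hts, hqs, Q, h, -map_sub]
      ring
    obtain ⟨φ, hφ, hφc, hφd⟩ := exists_cutoff _ hKc G hG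
    rw [← hdiv φ hφ hφc j]
    apply integral_congr_ae
    filter_upwards [hseg] with y hy
    rw [hφd y hy, hGd y hy]
    simp [P, Finset.sum_ite_eq, Pi.single_apply]
  have h0 : ρ =ᵐ[κ] 0 := by
    have : ∀ᵐ y ∂κ, ∀ k j, ρ y k j = 0 := by
      rw [ae_all_iff]; intro k
      rw [ae_all_iff]; exact key k
    filter_upwards [this] with y hy
    ext k j
    exact hy k j
  rw [WithDensityᵥEq.congr_ae h0, withDensityᵥ_zero]
end
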